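/- Let n ≥ 1, let F₀ be an invertible real n×n matrix and Q₀ a real n×n matrix such that A := sym(Q₀F₀^{-1}) is invertible. Then for every smooth compactly supported vector field ζ : ℝⁿ → ℝⁿ, writing B(x) = sym(∇ζ(x) F₀^{-1}), one has ∫_{ℝⁿ} |∇ζ(x)|² dx ≤ 2 |F₀|² |A^{-1}|⁴ ∫_{ℝⁿ} ( |A²B(x) + A B(x) A|² + |A² B(x)|² ) dx. (This is the Korn-type inequality (1.8) for M = D_Q𝒵₂(F₀,Q₀), where 𝒵₂(F,Q) = [sym(QF^{-1})]⁵ F^{-1,T} and ⟨D_Q𝒵₂(F₀,Q₀)Q : Q⟩ = |A²B + ABA|² + |A²B|² with B = sym(QF₀^{-1}), with constant γ = 2|F₀|²|A^{-1}|⁴.) -/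

import Mathlib

open Matrix MeasureTheory

/-- The Jacobian matrix of a vector field `ζ : ℝⁿ → ℝⁿ`: `(jac ζ x) i j = ∂ζ_i/∂x_j (x)`. -/
noncomputable def jac {n : ℕ} (ζ : (Fin n → ℝ) → (Fin n → ℝ)) (x : Fin n → ℝ) :
    Matrix (Fin n) (Fin n) ℝ :=
  Matrix.of fun i j => fderiv ℝ ζ x (Pi.single j 1) i

/-- The Frobenius inner product `⟨A : B⟩ = tr(Aᵀ B)`. -/
noncomputable def mip {n : ℕ} (A B : Matrix (Fin n) (Fin n) ℝ) : ℝ :=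
  (Aᵀ * B).trace


/-- The symmetric part `sym F = (F + Fᵀ)/2`. -/
noncomputable def msym {n : ℕ} (A : Matrix (Fin n) (Fin n) ℝ) : Matrix (Fin n) (Fin n) ℝ :=
  (2 : ℝ)⁻¹ • (A + Aᵀ)

open scoped ContDiff

theorem integral_fderiv_mul_fderiv_comm {E : Type*} [NormedAddCommGroup E] [NormedSpace ℝ E]
    [FiniteDimensional ℝ E] [MeasurableSpace E] [BorelSpace E] (μ : Measure E)
    [μ.IsAddHaarMeasure] {f g : E → ℝ} (hf : ContDiff ℝ ∞ f) (hg : ContDiff ℝ ∞ g)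
    (hfc : HasCompactSupport f) (v w : E) :
    ∫ x, fderiv ℝ f x v * fderiv ℝ g x w ∂μ = ∫ x, fderiv ℝ f x w * fderiv ℝ g x v ∂μ := by
  have hd (u : E) : ContDiff ℝ ∞ fun x => fderiv ℝ g x u :=
    (hg.fderiv_right (m := ∞) (by simp)).clm_apply contDiff_const
  have hfd (u : E) : Continuous fun x => fderiv ℝ f x u :=
    (hf.continuous_fderiv (by simp)).clm_apply continuous_const
  have hfdc (u : E) : HasCompactSupport fun x => fderiv ℝ f x u := hfc.fderiv_apply ℝ u
  have key (a b : E) : ∫ x, fderiv ℝ f x a * fderiv ℝ g x b ∂μ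
      = -∫ x, f x * fderiv ℝ (fun y => fderiv ℝ g y b) x a ∂μ := by
    rw [integral_mul_fderiv_eq_neg_fderiv_mul_of_integrable (v := a), neg_neg]
    · exact ((hfd a).mul (hd b).continuous).integrable_of_hasCompactSupport (hfdc a).mul_right
    · exact (hf.continuous.mul (((hd b).continuous_fderiv (by simp)).clm_apply
        continuous_const)).integrable_of_hasCompactSupport hfc.mul_right
    · exact (hf.continuous.mul (hd b).continuous).integrable_of_hasCompactSupport hfc.mul_right
    · exact fun x _ => hf.differentiable (by simp) x
    · exact fun x _ => (hd b).differentiable (by simp) x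
  rw [key, key]
  congr 2 with x
  have hs : IsSymmSndFDerivAt ℝ g x :=
    (contDiff_infty.1 hg 2).contDiffAt.isSymmSndFDerivAt (by simp)
  have hdd : DifferentiableAt ℝ (fderiv ℝ g) x :=
    (hg.fderiv_right (m := ∞) (by simp)).differentiable (by simp) x
  rw [fderiv_clm_apply hdd (differentiableAt_const _),
    fderiv_clm_apply hdd (differentiableAt_const _)]
  simp [hs.eq v w]

theorem mip_self_eq_sum {n : ℕ} (M : Matrix (Fin n) (Fin n) ℝ) :
    mip M M = ∑ i, ∑ j, M i j ^ 2 := by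
  simp only [mip, Matrix.trace, Matrix.diag_apply, Matrix.mul_apply, Matrix.transpose_apply, sq]
  exact Finset.sum_comm

theorem mip_self_nonneg {n : ℕ} (M : Matrix (Fin n) (Fin n) ℝ) : 0 ≤ mip M M := by
  rw [mip_self_eq_sum]
  positivity

theorem mip_mul_self_le {n : ℕ} (M N : Matrix (Fin n) (Fin n) ℝ) :
    mip (M * N) (M * N) ≤ mip M M * mip N N := by
  simp only [mip_self_eq_sum, Matrix.mul_apply]
  rw [Finset.sum_comm (f := fun i j => N i j ^ 2), Finset.sum_mul_sum]
  gcongr with i _ j _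
  exact Finset.sum_mul_sq_le_sq_mul_sq _ _ _

theorem two_mul_mip_msym_self {n : ℕ} (M : Matrix (Fin n) (Fin n) ℝ) :
    2 * mip (msym M) (msym M) = mip M M + (M * M).trace := by
  have h : (M * Mᵀ).trace = (Mᵀ * M).trace := Matrix.trace_mul_comm _ _
  have h' : (Mᵀ * Mᵀ).trace = (M * M).trace := by
    rw [← Matrix.transpose_mul, Matrix.trace_transpose]
  simp only [mip, msym, Matrix.transpose_smul, Matrix.transpose_add, Matrix.transpose_transpose,
    Matrix.smul_mul, Matrix.mul_smul, Matrix.add_mul, Matrix.mul_add, Matrix.trace_smul,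
    Matrix.trace_add, smul_eq_mul, h, h']
  ring

theorem jac_mul_apply {n : ℕ} {ζ : (Fin n → ℝ) → (Fin n → ℝ)} {x : Fin n → ℝ}
    (hζ : DifferentiableAt ℝ ζ x) (G : Matrix (Fin n) (Fin n) ℝ) (i k : Fin n) :
    (jac ζ x * G) i k = fderiv ℝ (fun y => ζ y i) x (G.col k) := by
  rw [fderiv_apply hζ i]
  conv_rhs => rw [← Finset.univ_sum_single (G.col k)]
  simp only [Matrix.mul_apply, jac, Matrix.of_apply, map_sum, ContinuousLinearMap.comp_apply,
    ContinuousLinearMap.proj_apply]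
  refine Finset.sum_congr rfl fun j _ => ?_
  have : (Pi.single j (G.col k j) : Fin n → ℝ) = G j k • Pi.single j 1 := by
    rw [← Pi.single_smul]; simp
  rw [this, map_smul, Pi.smul_apply, smul_eq_mul, mul_comm]

theorem integrable_comp_jac {n : ℕ} {ζ : (Fin n → ℝ) → (Fin n → ℝ)} (hζ : ContDiff ℝ ∞ ζ)
    (hζc : HasCompactSupport ζ) {Φ : Matrix (Fin n) (Fin n) ℝ → ℝ} (hΦ : Continuous Φ)
    (hΦ0 : Φ 0 = 0) : Integrable fun x => Φ (jac ζ x) := by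
  have hc : Continuous fun L : (Fin n → ℝ) →L[ℝ] (Fin n → ℝ) =>
      Matrix.of fun i j : Fin n => L (Pi.single j 1) i :=
    continuous_matrix fun i j => (continuous_apply i).comp (continuous_eval_const _)
  refine ((hΦ.comp hc).comp
    (hζ.continuous_fderiv (by simp))).integrable_of_hasCompactSupport ?_
  refine (hζc.fderiv ℝ).comp_left (g := Φ ∘ _) ?_
  rw [← hΦ0]
  rfl

theorem integral_trace_sq_jac_mul {n : ℕ} {ζ : (Fin n → ℝ) → (Fin n → ℝ)}
    (hζ : ContDiff ℝ ∞ ζ) (hζc : HasCompactSupport ζ) (G : Matrix (Fin n) (Fin n) ℝ) :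
    ∫ x, (jac ζ x * G * (jac ζ x * G)).trace = ∫ x, (jac ζ x * G).trace ^ 2 := by
  have hdiff := hζ.differentiable (by simp)
  have hi (a b c d : Fin n) : Integrable fun x => (jac ζ x * G) a b * (jac ζ x * G) c d :=
    integrable_comp_jac hζ hζc (Φ := fun M => (M * G) a b * (M * G) c d)
      (by fun_prop) (by simp)
  have hcomp (i : Fin n) : ContDiff ℝ ∞ fun x => ζ x i := contDiff_pi.1 hζ i
  have hcompc (i : Fin n) : HasCompactSupport fun x => ζ x i :=
    hζc.comp_left (g := fun y : Fin n → ℝ => y i) rfl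
  simp only [sq, Matrix.trace, Matrix.diag_apply, Matrix.mul_apply (M := jac ζ _ * G),
    Finset.sum_mul_sum]
  rw [integral_finsetSum _ fun i _ => integrable_finsetSum _ fun k _ => hi _ _ _ _,
    integral_finsetSum _ fun i _ => integrable_finsetSum _ fun k _ => hi _ _ _ _]
  refine Finset.sum_congr rfl fun i _ => ?_
  rw [integral_finsetSum _ fun k _ => hi _ _ _ _, integral_finsetSum _ fun k _ => hi _ _ _ _]
  refine Finset.sum_congr rfl fun k _ => ?_
  simp only [jac_mul_apply (hdiff _)]
  exact integral_fderiv_mul_fderiv_comm volume (hcomp i) (hcomp k) (hcompc i) _ _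

theorem continuous_mip_self {n : ℕ} :
    Continuous fun M : Matrix (Fin n) (Fin n) ℝ => mip M M := by
  unfold mip
  fun_prop

theorem continuous_msym {n : ℕ} :
    Continuous fun M : Matrix (Fin n) (Fin n) ℝ => msym M := by
  unfold msym
  fun_prop

theorem integral_mip_jac_mul_le {n : ℕ} {ζ : (Fin n → ℝ) → (Fin n → ℝ)}
    (hζ : ContDiff ℝ ∞ ζ) (hζc : HasCompactSupport ζ) (G : Matrix (Fin n) (Fin n) ℝ) :
    ∫ x, mip (jac ζ x * G) (jac ζ x * G)
      ≤ 2 * ∫ x, mip (msym (jac ζ x * G)) (msym (jac ζ x * G)) := by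
  have h1 : Integrable fun x => mip (jac ζ x * G) (jac ζ x * G) :=
    integrable_comp_jac hζ hζc (continuous_mip_self.comp (by fun_prop : Continuous (· * G)))
      (by simp [mip])
  have h2 : Integrable fun x => (jac ζ x * G * (jac ζ x * G)).trace :=
    integrable_comp_jac hζ hζc (Φ := fun M => (M * G * (M * G)).trace) (by fun_prop) (by simp)
  rw [← integral_const_mul]
  simp only [two_mul_mip_msym_self]
  rw [integral_add h1 h2, integral_trace_sq_jac_mul hζ hζc]
  exact le_add_of_nonneg_right (integral_nonneg fun x => sq_nonneg _)

theorem mip_self_le_of_isUnit_det {n : ℕ} {A : Matrix (Fin n) (Fin n) ℝ} (hA : IsUnit A.det)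
    (B : Matrix (Fin n) (Fin n) ℝ) :
    mip B B ≤ mip A⁻¹ A⁻¹ ^ 2 * mip (A ^ 2 * B) (A ^ 2 * B) := by
  have h : B = A⁻¹ * A⁻¹ * (A ^ 2 * B) := by
    rw [sq, Matrix.mul_assoc A⁻¹, Matrix.mul_assoc A A,
      Matrix.nonsing_inv_mul_cancel_left _ _ hA, Matrix.nonsing_inv_mul_cancel_left _ _ hA]
  calc mip B B = mip (A⁻¹ * A⁻¹ * (A ^ 2 * B)) (A⁻¹ * A⁻¹ * (A ^ 2 * B)) := by rw [← h]
    _ ≤ mip (A⁻¹ * A⁻¹) (A⁻¹ * A⁻¹) * mip (A ^ 2 * B) (A ^ 2 * B) := mip_mul_self_le _ _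
    _ ≤ mip A⁻¹ A⁻¹ ^ 2 * mip (A ^ 2 * B) (A ^ 2 * B) := by
      rw [sq (mip _ _)]
      exact mul_le_mul_of_nonneg_right (mip_mul_self_le _ _) (mip_self_nonneg _)

theorem stmt_7 {n : ℕ} (hn : 1 ≤ n)
    (F₀ Q₀ : Matrix (Fin n) (Fin n) ℝ) (hF₀ : IsUnit F₀.det)
    (A : Matrix (Fin n) (Fin n) ℝ) (hA : A = msym (Q₀ * F₀⁻¹)) (hAinv : IsUnit A.det)
    (ζ : (Fin n → ℝ) → (Fin n → ℝ)) (hζ : ContDiff ℝ (⊤ : ℕ∞) ζ)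
    (hζc : HasCompactSupport ζ)
    (B : (Fin n → ℝ) → Matrix (Fin n) (Fin n) ℝ)
    (hB : ∀ x, B x = msym (jac ζ x * F₀⁻¹)) :
    ∫ x, mip (jac ζ x) (jac ζ x)
      ≤ 2 * mip F₀ F₀ * (mip A⁻¹ A⁻¹) ^ 2 *
        ∫ x, (mip (A ^ 2 * B x + A * B x * A) (A ^ 2 * B x + A * B x * A)
              + mip (A ^ 2 * B x) (A ^ 2 * B x)) := by
  obtain rfl : B = fun x => msym (jac ζ x * F₀⁻¹) := funext hB
  have hs : Continuous fun M : Matrix (Fin n) (Fin n) ℝ => msym (M * F₀⁻¹) :=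
    continuous_msym.comp (by fun_prop)
  have hJ : ∫ x, mip (jac ζ x) (jac ζ x)
      ≤ mip F₀ F₀ * ∫ x, mip (jac ζ x * F₀⁻¹) (jac ζ x * F₀⁻¹) := by
    rw [← integral_const_mul]
    refine integral_mono (integrable_comp_jac hζ hζc continuous_mip_self (by simp [mip]))
      ((integrable_comp_jac hζ hζc (continuous_mip_self.comp
        (by fun_prop : Continuous (· * F₀⁻¹))) (by simp [mip])).const_mul _) fun x => ?_
    have h := mip_mul_self_le (jac ζ x * F₀⁻¹) F₀
    rw [Matrix.nonsing_inv_mul_cancel_right _ _ hF₀] at h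
    rwa [mul_comm]
  have hM : ∫ x, mip (msym (jac ζ x * F₀⁻¹)) (msym (jac ζ x * F₀⁻¹))
      ≤ mip A⁻¹ A⁻¹ ^ 2 * ∫ x, (mip (A ^ 2 * msym (jac ζ x * F₀⁻¹) + A * msym (jac ζ x * F₀⁻¹) * A)
          (A ^ 2 * msym (jac ζ x * F₀⁻¹) + A * msym (jac ζ x * F₀⁻¹) * A)
        + mip (A ^ 2 * msym (jac ζ x * F₀⁻¹)) (A ^ 2 * msym (jac ζ x * F₀⁻¹))) := by
    rw [← integral_const_mul]
    refine integral_mono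
      (integrable_comp_jac hζ hζc (continuous_mip_self.comp hs) (by simp [mip, msym]))
      (Integrable.const_mul (Integrable.add
        (integrable_comp_jac hζ hζc (continuous_mip_self.comp
          (by fun_prop : Continuous fun M =>
            A ^ 2 * msym (M * F₀⁻¹) + A * msym (M * F₀⁻¹) * A)) (by simp [mip, msym]))
        (integrable_comp_jac hζ hζc (continuous_mip_self.comp
          (by fun_prop : Continuous fun M => A ^ 2 * msym (M * F₀⁻¹))) (by simp [mip, msym]))) _)
      fun x => (mip_self_le_of_isUnit_det hAinv _).trans ?_
    gcongr
    exact le_add_of_nonneg_left (mip_self_nonneg _)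
  calc ∫ x, mip (jac ζ x) (jac ζ x)
      ≤ mip F₀ F₀ * ∫ x, mip (jac ζ x * F₀⁻¹) (jac ζ x * F₀⁻¹) := hJ
    _ ≤ mip F₀ F₀ * (2 * _) := mul_le_mul_of_nonneg_left
        ((integral_mip_jac_mul_le hζ hζc _).trans (mul_le_mul_of_nonneg_left hM zero_le_two))
        (mip_self_nonneg _)
    _ = _ := by ring
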